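/- arXiv:2301.02141 — 2 statements merged into one kernel-verified Lean document; each statement's English description precedes it below -/
import Mathlib

section
/- Refined Lang's formula: For all integers n ≥ 1 and k ≥ 1, the power sum satisfies S_k(n) = Σ_{m=1}^{k} (-1)^{m-1} m σ_m(1,2,...,n) h_{k-m}(1,2,...,n), with the convention σ_m(1,2,...,n) = 0 whenever m > n. -/
/-- The `m`-th elementary symmetric function of the family `f` over the finite index set `s`:
the sum over all `m`-element subsets of `s` of the product of the values of `f`. -/
def esymmOn {ι R : Type*} [CommRing R] (s : Finset ι) (m : ℕ) (f : ι → R) : R :=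
  ∑ t ∈ s.powersetCard m, ∏ i ∈ t, f i

/-- The `m`-th complete homogeneous symmetric function of the family `f` over the finite
index set `s`: the sum over all multisets of elements of `s` of size `m` of the product
of the values of `f` (with multiplicity). -/
def hsymmOn {ι R : Type*} [DecidableEq ι] [CommRing R] (s : Finset ι) (m : ℕ) (f : ι → R) : R :=
  ∑ t ∈ s.sym m, ((t : Multiset ι).map f).prod

open PowerSeries in
/-- The signed generating function of the elementary symmetric functions. -/
noncomputable def esymmSeries {ι R : Type*} [CommRing R] (s : Finset ι) (f : ι → R) : R⟦X⟧ :=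
  PowerSeries.mk fun m => (-1) ^ m * esymmOn s m f

open PowerSeries in
/-- The generating function of the complete homogeneous symmetric functions. -/
noncomputable def hsymmSeries {ι R : Type*} [DecidableEq ι] [CommRing R] (s : Finset ι)
    (f : ι → R) : R⟦X⟧ :=
  PowerSeries.mk fun m => hsymmOn s m f

section

variable {ι R : Type*} [CommRing R]

open PowerSeries

theorem esymmOn_zero (s : Finset ι) (f : ι → R) : esymmOn s 0 f = 1 := by
  simp [esymmOn]

theorem esymmSeries_empty (f : ι → R) : esymmSeries ∅ f = 1 := by
  ext m
  cases m with
  | zero => simp [esymmSeries, esymmOn_zero]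
  | succ m => simp [esymmSeries, esymmOn, coeff_one,
      Finset.powersetCard_eq_empty.2 (show (∅ : Finset ι).card < m + 1 by simp)]

theorem one_sub_C_mul_X_mul_mk_pow (a : R) : (1 - C a * X) * mk (fun m => a ^ m) = 1 := by
  ext m
  rw [sub_mul, one_mul, mul_assoc, map_sub, coeff_C_mul]
  cases m with
  | zero => simp
  | succ m => simp [coeff_succ_X_mul, coeff_one, pow_succ']

variable [DecidableEq ι]

theorem hsymmOn_zero (s : Finset ι) (f : ι → R) : hsymmOn s 0 f = 1 := by
  rw [hsymmOn, Finset.sym_zero, Finset.sum_singleton]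
  exact Multiset.prod_zero

theorem esymmOn_succ_insert {s : Finset ι} {a : ι} (ha : a ∉ s) (m : ℕ) (f : ι → R) :
    esymmOn (insert a s) (m + 1) f = esymmOn s (m + 1) f + f a * esymmOn s m f := by
  have not_mem {t : Finset ι} {j : ℕ} (ht : t ∈ s.powersetCard j) : a ∉ t :=
    fun h => ha ((Finset.mem_powersetCard.1 ht).1 h)
  unfold esymmOn
  rw [Finset.powersetCard_succ_insert ha, Finset.sum_union, Finset.sum_image, Finset.mul_sum]
  · congr 1
    exact Finset.sum_congr rfl fun t ht => Finset.prod_insert (not_mem ht)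
  · intro t ht u hu h
    rw [← Finset.erase_insert (not_mem ht), h, Finset.erase_insert (not_mem hu)]
  · rw [Finset.disjoint_left]
    intro t ht h
    obtain ⟨u, -, rfl⟩ := Finset.mem_image.1 h
    exact not_mem ht (Finset.mem_insert_self a u)

theorem hsymmOn_succ_insert {s : Finset ι} {a : ι} (ha : a ∉ s) (m : ℕ) (f : ι → R) :
    hsymmOn (insert a s) (m + 1) f = hsymmOn s (m + 1) f + f a * hsymmOn (insert a s) m f := by
  have hmem : ((insert a s).sym (m + 1)).filter (fun t => a ∈ t) =
      ((insert a s).sym m).image (Sym.cons a) := by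
    ext t
    simp only [Finset.mem_filter, Finset.mem_image, Finset.mem_sym_iff]
    constructor
    · rintro ⟨ht, hat⟩
      obtain ⟨u, rfl⟩ := Sym.exists_cons_of_mem hat
      exact ⟨u, fun i hi => ht i (Sym.mem_cons_of_mem hi), rfl⟩
    · rintro ⟨u, hu, rfl⟩
      refine ⟨fun i hi => ?_, Sym.mem_cons_self a u⟩
      rcases Sym.mem_cons.1 hi with rfl | hi
      · exact Finset.mem_insert_self _ _
      · exact hu i hi
  have hnot : ((insert a s).sym (m + 1)).filter (fun t => ¬ a ∈ t) = s.sym (m + 1) := by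
    ext t
    simp only [Finset.mem_filter, Finset.mem_sym_iff]
    constructor
    · rintro ⟨ht, hat⟩ i hi
      exact Finset.mem_of_mem_insert_of_ne (ht i hi) fun h => hat (h ▸ hi)
    · exact fun ht => ⟨fun i hi => Finset.mem_insert_of_mem (ht i hi), fun h => ha (ht a h)⟩
  unfold hsymmOn
  rw [← Finset.sum_filter_add_sum_filter_not _ (fun t => a ∈ t), hmem, hnot, add_comm,
    Finset.sum_image fun t _ u _ h => Sym.cons_inj_right a t u |>.1 h, Finset.mul_sum]
  congr 1
  exact Finset.sum_congr rfl fun t _ => by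
    rw [Sym.coe_cons, Multiset.map_cons, Multiset.prod_cons]

theorem hsymmSeries_empty (f : ι → R) : hsymmSeries ∅ f = 1 := by
  ext m
  cases m with
  | zero => simp [hsymmSeries, hsymmOn_zero]
  | succ m => simp [hsymmSeries, hsymmOn, coeff_one]

theorem esymmSeries_insert {s : Finset ι} {a : ι} (ha : a ∉ s) (f : ι → R) :
    esymmSeries (insert a s) f = (1 - C (f a) * X) * esymmSeries s f := by
  ext m
  rw [sub_mul, one_mul, mul_assoc, map_sub, coeff_C_mul]
  cases m with
  | zero => simp [esymmSeries, esymmOn_zero]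
  | succ m =>
    simp only [esymmSeries, coeff_mk, coeff_succ_X_mul, esymmOn_succ_insert ha]
    ring

theorem hsymmSeries_insert {s : Finset ι} {a : ι} (ha : a ∉ s) (f : ι → R) :
    (1 - C (f a) * X) * hsymmSeries (insert a s) f = hsymmSeries s f := by
  ext m
  rw [sub_mul, one_mul, mul_assoc, map_sub, coeff_C_mul]
  cases m with
  | zero => simp [hsymmSeries, hsymmOn_zero]
  | succ m =>
    simp only [hsymmSeries, coeff_mk, coeff_succ_X_mul, hsymmOn_succ_insert ha]
    ring

theorem esymmSeries_mul_hsymmSeries (s : Finset ι) (f : ι → R) :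
    esymmSeries s f * hsymmSeries s f = 1 := by
  induction s using Finset.induction_on with
  | empty => simp [esymmSeries_empty, hsymmSeries_empty]
  | insert a s ha ih =>
    rw [esymmSeries_insert ha, mul_right_comm, hsymmSeries_insert ha, mul_comm, ih]

/-- The logarithmic derivative of the signed generating function of the elementary symmetric
functions generates the power sums. -/
theorem neg_derivative_esymmSeries_mul_hsymmSeries (s : Finset ι) (f : ι → R) :
    -(d⁄dX R (esymmSeries s f)) * hsymmSeries s f = mk fun m => ∑ i ∈ s, f i ^ (m + 1) := by
  induction s using Finset.induction_on with
  | empty =>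
    ext m
    simp [esymmSeries_empty]
  | insert a s ha ih =>
    have hgeom : esymmSeries s f * hsymmSeries (insert a s) f = mk fun m => f a ^ m := by
      have h := esymmSeries_mul_hsymmSeries s f
      rw [← hsymmSeries_insert ha] at h
      linear_combination (mk fun m => f a ^ m) * h -
        esymmSeries s f * hsymmSeries (insert a s) f * one_sub_C_mul_X_mul_mk_pow (f a)
    have hsum : (mk fun m => ∑ i ∈ insert a s, f i ^ (m + 1)) =
        C (f a) * mk (fun m => f a ^ m) + mk fun m => ∑ i ∈ s, f i ^ (m + 1) := by
      ext m
      simp [Finset.sum_insert ha, pow_succ', coeff_C_mul]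
    have hderiv : d⁄dX R (esymmSeries (insert a s) f) =
        (1 - C (f a) * X) * d⁄dX R (esymmSeries s f) - C (f a) * esymmSeries s f := by
      rw [esymmSeries_insert ha, Derivation.leibniz]
      simp only [map_sub, Derivation.leibniz, derivative_C, derivative_X, smul_eq_mul,
        Derivation.map_one_eq_zero]
      ring
    rw [hsum, ← ih, ← hgeom, hderiv, ← hsymmSeries_insert ha]
    ring

/-- The power sums in terms of elementary and complete homogeneous symmetric functions. -/
theorem sum_pow_eq_sum_esymmOn_mul_hsymmOn (s : Finset ι) (f : ι → R) {k : ℕ} (hk : 1 ≤ k) :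
    ∑ i ∈ s, f i ^ k =
      ∑ m ∈ Finset.Icc 1 k, (-1) ^ (m - 1) * (m : R) * esymmOn s m f * hsymmOn s (k - m) f := by
  obtain ⟨k, rfl⟩ := Nat.exists_eq_add_of_le' hk
  have h := congrArg (coeff k) (neg_derivative_esymmSeries_mul_hsymmSeries s f)
  rw [coeff_mk, coeff_mul, Finset.Nat.sum_antidiagonal_eq_sum_range_succ_mk] at h
  rw [← h, ← Finset.Ico_add_one_right_eq_Icc, Finset.sum_Ico_eq_sum_range]
  refine Finset.sum_congr (by simp) fun m _ => ?_
  rw [add_comm 1 m, Nat.add_sub_add_right, Nat.add_sub_add_right, Nat.sub_zero]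
  simp only [map_neg, coeff_derivative, esymmSeries, hsymmSeries, coeff_mk]
  push_cast
  ring

end

/-- Refined Lang's formula: for `n ≥ 1`, `k ≥ 1`,
`S_k(n) = ∑_{m=1}^{k} (-1)^{m-1} m σ_m(1,…,n) h_{k-m}(1,…,n)`. -/
theorem refined_lang_formula (n k : ℕ) (hn : 1 ≤ n) (hk : 1 ≤ k) :
    ∑ i ∈ Finset.Icc 1 n, (i : ℤ) ^ k =
      ∑ m ∈ Finset.Icc 1 k, (-1) ^ (m - 1) * (m : ℤ) *
        esymmOn (Finset.Icc 1 n) m (fun i => (i : ℤ)) *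
        hsymmOn (Finset.Icc 1 n) (k - m) (fun i => (i : ℤ)) :=
  sum_pow_eq_sum_esymmOn_mul_hsymmOn (Finset.Icc 1 n) (fun i => (i : ℤ)) hk
end

section
/- For every integer k ≥ 1, the Bernoulli numbers satisfy the recursion B_{2k} = (2/(2k+1)) Σ_{j=1}^{k} j · C(2k+1, 2j+1) (1/2^{2k−1} − 1/2^{2j}) B_{2k−2j}, where C(a,b) denotes the binomial coefficient. -/
open Finset in
theorem Finset.sum_range_two_mul_add {M : Type*} [AddCommMonoid M] (f : ℕ → M) (n : ℕ) :
    ∑ i ∈ range (2 * n), f i = ∑ j ∈ range n, (f (2 * j) + f (2 * j + 1)) := by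
  induction n with
  | zero => simp
  | succ n ih => rw [mul_add, sum_range_succ, sum_range_succ, ih, sum_range_succ, add_assoc]

open PowerSeries in
/-- The duplication formula for Bernoulli polynomials, evaluated at `0`. -/
theorem bernoulliPolynomial_eval_one_half (n : ℕ) :
    (Polynomial.bernoulli n).eval (1 / 2 : ℚ) = (2 * (1 / 2) ^ n - 1) * bernoulli n := by
  set E : ℚ⟦X⟧ := rescale (1 / 2 : ℚ) (exp ℚ) with hE
  have hEE : E * E = exp ℚ := by
    rw [hE, exp_mul_exp_eq_exp_add, add_halves, rescale_one, RingHom.id_apply]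
  have hb := bernoulliPowerSeries_mul_exp_sub_one ℚ
  have hF := Polynomial.bernoulli_generating_function (1 / 2 : ℚ)
  rw [← hE] at hF
  have hb' := congrArg (rescale (1 / 2 : ℚ)) hb
  rw [map_mul, map_sub, map_one, ← hE, rescale_X] at hb'
  have hC : (C (1 / 2 : ℚ) : ℚ⟦X⟧) * 2 = 1 := by
    rw [show (2 : ℚ⟦X⟧) = C (2 : ℚ) from (map_ofNat C 2).symm, ← map_mul]; norm_num
  have hne : exp ℚ - 1 ≠ 0 := by
    intro h
    rw [h, mul_zero] at hb
    exact X_ne_zero hb.symm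
  have key := mul_right_cancel₀ (b := exp ℚ - 1) hne (a := ((mk fun n => Polynomial.aeval (1 / 2 : ℚ)
      ((1 / n.factorial : ℚ) • Polynomial.bernoulli n)) + bernoulliPowerSeries ℚ))
      (c := 2 * rescale (1 / 2 : ℚ) (bernoulliPowerSeries ℚ)) (by
    rw [add_mul, hF, hb, ← hEE]
    linear_combination (-2 * (E + 1)) * hb' - X * (E + 1) * hC)
  have h := congrArg (coeff n) key
  rw [show (2 : ℚ⟦X⟧) = C (2 : ℚ) from (map_ofNat C 2).symm, map_add, coeff_C_mul, coeff_rescale,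
    coeff_mk, bernoulliPowerSeries, coeff_mk, Polynomial.coe_aeval_eq_eval, Polynomial.eval_smul,
    smul_eq_mul, Algebra.algebraMap_self, RingHom.id_apply] at h
  have hn : (n.factorial : ℚ) ≠ 0 := by positivity
  field_simp at h
  field_simp
  linear_combination h

open Finset in
theorem sum_mul_choose_mul_bernoulli_mul_pow (k : ℕ) (x : ℚ) :
    ∑ j ∈ Icc 1 k, 2 * (j : ℚ) * ((2 * k + 1).choose (2 * j + 1) : ℚ) *
        bernoulli (2 * k - 2 * j) * x ^ (2 * j + 1) =
      (2 * k + 1) * x * (Polynomial.bernoulli (2 * k)).eval x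
        - (Polynomial.bernoulli (2 * k + 1)).eval x
        + (2 * k - 1) * (2 * k + 1) / 2 * x ^ (2 * k) := by
  have hsum (n : ℕ) (y : ℚ) : (Polynomial.bernoulli n).eval y =
      ∑ i ∈ range (n + 1), bernoulli (n - i) * n.choose i * y ^ i := by
    simp [Polynomial.bernoulli_def, Polynomial.eval_finsetSum]
  have hder : (2 * k + 1) * x * (Polynomial.bernoulli (2 * k)).eval x =
      ∑ i ∈ range (2 * (k + 1)),
        i * (bernoulli (2 * k + 1 - i) * (2 * k + 1).choose i * x ^ i) := by
    rw [show 2 * (k + 1) = 2 * k + 1 + 1 by ring, sum_range_succ', hsum, mul_sum]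
    simp only [Nat.cast_zero, zero_mul, add_zero, Nat.add_sub_add_right]
    refine sum_congr rfl fun i _ => ?_
    have h : ((2 * k + 1 : ℕ) : ℚ) * (2 * k).choose i =
        (2 * k + 1).choose (i + 1) * (i + 1 : ℕ) := mod_cast Nat.add_one_mul_choose_eq (2 * k) i
    push_cast at h ⊢
    linear_combination x ^ (i + 1) * bernoulli (2 * k - i) * h
  rw [hder, hsum, show 2 * k + 1 + 1 = 2 * (k + 1) by ring, ← sum_sub_distrib,
    sum_range_two_mul_add, sum_add_distrib, sum_range_succ, sum_eq_zero (s := range k)]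
  · rw [range_eq_Ico, sum_eq_sum_Ico_succ_bot k.succ_pos, zero_add, ← Ico_add_one_right_eq_Icc]
    rw [sum_congr rfl fun j _ => show (2 * j * (2 * k + 1).choose (2 * j + 1) *
        bernoulli (2 * k - 2 * j) * x ^ (2 * j + 1) : ℚ) = (2 * j + 1 : ℕ) *
        (bernoulli (2 * k + 1 - (2 * j + 1)) * (2 * k + 1).choose (2 * j + 1) * x ^ (2 * j + 1)) -
        bernoulli (2 * k + 1 - (2 * j + 1)) * (2 * k + 1).choose (2 * j + 1) * x ^ (2 * j + 1) by
      rw [Nat.add_sub_add_right]; push_cast; ring]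
    rw [Nat.succ_eq_add_one, Nat.add_sub_cancel_left, bernoulli_one, Nat.choose_succ_self_right]
    push_cast
    ring
  · intro j hj
    rw [mem_range] at hj
    rw [bernoulli_eq_zero_of_odd (n := 2 * k + 1 - 2 * j) ⟨k - j, by omega⟩ (by omega)]
    ring

/-- For `k ≥ 1`, the Bernoulli numbers satisfy the recursion
`B_{2k} = (2/(2k+1)) ∑_{j=1}^{k} j·C(2k+1, 2j+1)·(1/2^{2k−1} − 1/2^{2j})·B_{2k−2j}`. -/
theorem bernoulli_even_recursion (k : ℕ) (hk : 1 ≤ k) :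
    bernoulli (2 * k) =
      (2 / (2 * k + 1) : ℚ) * ∑ j ∈ Finset.Icc 1 k, (j : ℚ) *
        (Nat.choose (2 * k + 1) (2 * j + 1) : ℚ) *
        (1 / 2 ^ (2 * k - 1) - 1 / 2 ^ (2 * j)) * bernoulli (2 * k - 2 * j) := by
  have hodd : Odd (2 * k + 1) := ⟨k, rfl⟩
  have h₁ := sum_mul_choose_mul_bernoulli_mul_pow k 1
  have h₂ := sum_mul_choose_mul_bernoulli_mul_pow k (1 / 2)
  rw [Polynomial.bernoulli_eval_one, Polynomial.bernoulli_eval_one,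
    bernoulli'_eq_zero_of_odd hodd (by omega),
    ← bernoulli_eq_bernoulli'_of_ne_one (by omega : 2 * k ≠ 1)] at h₁
  rw [bernoulliPolynomial_eval_one_half, bernoulliPolynomial_eval_one_half,
    bernoulli_eq_zero_of_odd hodd (by omega)] at h₂
  have hpow : (1 / 2 ^ (2 * k - 1) : ℚ) = 2 * (1 / 2) ^ (2 * k) := by
    obtain ⟨m, rfl⟩ := Nat.exists_eq_add_of_le' hk
    rw [show 2 * (m + 1) - 1 = 2 * m + 1 by omega, one_div_pow]
    field_simp
    ring
  have hsplit : ∑ j ∈ Finset.Icc 1 k, (j : ℚ) * (Nat.choose (2 * k + 1) (2 * j + 1) : ℚ) *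
        (1 / 2 ^ (2 * k - 1) - 1 / 2 ^ (2 * j)) * bernoulli (2 * k - 2 * j) =
      (1 / 2) ^ (2 * k) * ∑ j ∈ Finset.Icc 1 k, 2 * (j : ℚ) *
        ((2 * k + 1).choose (2 * j + 1) : ℚ) * bernoulli (2 * k - 2 * j) * 1 ^ (2 * j + 1) -
      ∑ j ∈ Finset.Icc 1 k, 2 * (j : ℚ) * ((2 * k + 1).choose (2 * j + 1) : ℚ) *
        bernoulli (2 * k - 2 * j) * (1 / 2) ^ (2 * j + 1) := by
    rw [Finset.mul_sum, ← Finset.sum_sub_distrib]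
    refine Finset.sum_congr rfl fun j _ => ?_
    rw [hpow, ← one_div_pow 2 (2 * j), one_pow]
    ring
  rw [hsplit, h₁, h₂, one_pow]
  have hk' : (2 * k + 1 : ℚ) ≠ 0 := by positivity
  field_simp
  ring
end
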